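/- arXiv:0906.0282 — 10 statements merged into one kernel-verified Lean document; each statement's English description precedes it below -/
import Mathlib

section
/- Let A be a subring of a reduced commutative ring B such that B is a rational extension of A. If B⁺ is a maximal partial ordering of B, then B⁺ ∩ A is a maximal partial ordering of A. -/
/-- A partial ordering of (the subring `S` of) a commutative ring `R`:
a subset `P ⊆ S` with `P + P ⊆ P`, `P·P ⊆ P`, `x² ∈ P` for all `x ∈ S`,
and `P ∩ (−P) = {0}`. -/
def IsPartialOrderingOn {R : Type*} [CommRing R] (S : Subring R) (P : Set R) : Prop :=
  P ⊆ ↑S ∧ (∀ x ∈ P, ∀ y ∈ P, x + y ∈ P) ∧ (∀ x ∈ P, ∀ y ∈ P, x * y ∈ P) ∧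
    (∀ x ∈ S, x ^ 2 ∈ P) ∧ ∀ x, x ∈ P → -x ∈ P → x = 0

/-- A maximal partial ordering: maximal w.r.t. inclusion among partial orderings. -/
def IsMaxPartialOrderingOn {R : Type*} [CommRing R] (S : Subring R) (P : Set R) : Prop :=
  IsPartialOrderingOn S P ∧ ∀ Q : Set R, IsPartialOrderingOn S Q → P ⊆ Q → Q = P

/-- Let `A` be a subring of a reduced commutative ring `B` such that `B` is a rational
extension of `A`. If `B⁺` is a maximal partial ordering of `B`, then `B⁺ ∩ A` is a
maximal partial ordering of `A`. -/
theorem maxPartialOrdering_inter_subring {B : Type*} [CommRing B] [IsReduced B] (A : Subring B)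
    (hrat : ∀ b b' : B, b' ≠ 0 → ∃ a ∈ A, a * b ∈ A ∧ a * b' ≠ 0)
    (P : Set B) (hP : IsMaxPartialOrderingOn (⊤ : Subring B) P) :
    IsMaxPartialOrderingOn A (P ∩ ↑A) := by
  obtain ⟨⟨-, hadd, hmul, hsq, hneg⟩, hmax⟩ := hP
  have sq_mem : ∀ x : B, x ^ 2 ∈ P := fun x => hsq x (Subring.mem_top x)
  have zero_mem : (0 : B) ∈ P := by simpa using sq_mem 0
  have one_mem : (1 : B) ∈ P := by simpa using sq_mem 1
  have eq_zero : ∀ x ∈ P, ∀ y ∈ P, x + y = 0 → x = 0 := fun x hx y hy h =>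
    hneg x hx (by rwa [neg_eq_of_add_eq_zero_right h])
  have eq_zero_of_sq_mul : ∀ a b : B, a ^ 2 * b = 0 → a * b = 0 := fun a b h =>
    pow_eq_zero_iff two_ne_zero |>.mp (by linear_combination b * h)
  refine ⟨⟨Set.inter_subset_right, fun x hx y hy => ⟨hadd x hx.1 y hy.1, A.add_mem hx.2 hy.2⟩,
    fun x hx y hy => ⟨hmul x hx.1 y hy.1, A.mul_mem hx.2 hy.2⟩,
    fun x hx => ⟨sq_mem x, A.pow_mem hx 2⟩, fun x hx hx' => hneg x hx.1 hx'.1⟩, ?_⟩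
  rintro Q ⟨hQA, -, hQmul, -, hQneg⟩ hPQ
  refine subset_antisymm (fun q hq => ⟨?_, hQA hq⟩) hPQ
  have fst_eq_zero : ∀ p ∈ P, ∀ r ∈ P, p + q * r = 0 → p = 0 := by
    intro p hp r hr h
    by_contra hp0
    obtain ⟨a, ha, har, hap⟩ := hrat r p hp0
    have hr' : a ^ 2 * r ∈ A := by
      simpa [pow_two, mul_assoc] using A.mul_mem ha har
    have hp_eq : a ^ 2 * p = -(q * (a ^ 2 * r)) := by linear_combination a ^ 2 * h
    have hp' : a ^ 2 * p ∈ A := hp_eq ▸ A.neg_mem (A.mul_mem (hQA hq) hr')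
    refine hap (eq_zero_of_sq_mul a p (hQneg _ (hPQ ⟨hmul _ (sq_mem a) _ hp, hp'⟩) ?_))
    rw [hp_eq, neg_neg]
    exact hQmul _ hq _ (hPQ ⟨hmul _ (sq_mem a) _ hr, hr'⟩)
  have hT : IsPartialOrderingOn (⊤ : Subring B) {x | ∃ p ∈ P, ∃ r ∈ P, x = p + q * r} := by
    refine ⟨fun _ _ => Subring.mem_top _, ?_, ?_, fun x _ => ⟨x ^ 2, sq_mem x, 0, zero_mem, by simp⟩,
      ?_⟩
    · rintro _ ⟨p, hp, r, hr, rfl⟩ _ ⟨p', hp', r', hr', rfl⟩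
      exact ⟨p + p', hadd _ hp _ hp', r + r', hadd _ hr _ hr', by ring⟩
    · rintro _ ⟨p, hp, r, hr, rfl⟩ _ ⟨p', hp', r', hr', rfl⟩
      exact ⟨p * p' + q ^ 2 * (r * r'),
        hadd _ (hmul _ hp _ hp') _ (hmul _ (sq_mem q) _ (hmul _ hr _ hr')),
        p * r' + r * p', hadd _ (hmul _ hp _ hr') _ (hmul _ hr _ hp'), by ring⟩
    · rintro _ ⟨p, hp, r, hr, rfl⟩ ⟨p', hp', r', hr', h⟩
      have hpp : p + p' = 0 :=
        fst_eq_zero _ (hadd _ hp _ hp') _ (hadd _ hr _ hr') (by linear_combination -h)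
      have hqr : q * r = 0 := eq_zero_of_sq_mul q r <|
        eq_zero _ (hmul _ (sq_mem q) _ hr) _ (hmul _ (sq_mem q) _ hr')
          (by linear_combination -q * h - q * hpp)
      rw [eq_zero p hp p' hp' hpp, hqr, add_zero]
  rw [← hmax _ hT fun p hp => ⟨p, hp, 0, zero_mem, by simp⟩]
  exact ⟨0, zero_mem, 1, one_mem, by simp⟩
end

section
/- Let A be a subring of a reduced commutative ring B such that B is a rational extension of A. Then the map P̃ ↦ P̃ ∩ A is a bijection from the set of maximal partial orderings of B onto the set of maximal partial orderings of A. -/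
/-- An element outside a maximal partial ordering `P` of a reduced ring is excluded by some
`s ∈ P` with `0 ≠ -(x * s) ∈ P`. -/
theorem IsMaxPartialOrderingOn.exists_neg_mul_mem {R : Type*} [CommRing R] [IsReduced R]
    {S : Subring R} {P : Set R} (hP : IsMaxPartialOrderingOn S P) {x : R} (hx : x ∈ S)
    (hxP : x ∉ P) : ∃ s ∈ P, -(x * s) ∈ P ∧ x * s ≠ 0 := by
  obtain ⟨⟨hsub, hadd, hmul, hsq, hanti⟩, hmax⟩ := hP
  have h0 : (0 : R) ∈ P := by simpa using hsq 0 S.zero_mem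
  have h1 : (1 : R) ∈ P := by simpa using hsq 1 S.one_mem
  by_contra! hcon
  refine hxP ?_
  have hQ : IsPartialOrderingOn S {y | ∃ p ∈ P, ∃ q ∈ P, y = p + x * q} := by
    refine ⟨?_, ?_, ?_, ?_, ?_⟩
    · rintro _ ⟨p, hp, q, hq, rfl⟩
      exact S.add_mem (hsub hp) (S.mul_mem hx (hsub hq))
    · rintro _ ⟨p, hp, q, hq, rfl⟩ _ ⟨p', hp', q', hq', rfl⟩
      exact ⟨p + p', hadd _ hp _ hp', q + q', hadd _ hq _ hq', by ring⟩
    · rintro _ ⟨p, hp, q, hq, rfl⟩ _ ⟨p', hp', q', hq', rfl⟩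
      exact ⟨p * p' + x ^ 2 * (q * q'),
        hadd _ (hmul _ hp _ hp') _ (hmul _ (hsq x hx) _ (hmul _ hq _ hq')),
        p * q' + q * p', hadd _ (hmul _ hp _ hq') _ (hmul _ hq _ hp'), by ring⟩
    · exact fun y hy => ⟨y ^ 2, hsq y hy, 0, h0, by ring⟩
    · rintro _ ⟨p, hp, q, hq, rfl⟩ ⟨p', hp', q', hq', h⟩
      have hxs : x * (q + q') = 0 := by
        refine hcon _ (hadd _ hq _ hq') ?_
        rw [show -(x * (q + q')) = p + p' by linear_combination h]
        exact hadd _ hp _ hp'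
      have hp0 : p = 0 := by
        refine hanti p hp ?_
        rwa [show -p = p' by linear_combination h + hxs]
      have hxq : x ^ 2 * q = 0 := by
        refine hanti _ (hmul _ (hsq x hx) _ hq) ?_
        rw [show -(x ^ 2 * q) = x ^ 2 * q' by linear_combination -x * hxs]
        exact hmul _ (hsq x hx) _ hq'
      have hxq' : x * q = 0 := by
        refine eq_zero_of_pow_eq_zero (n := 2) ?_
        linear_combination q * hxq
      rw [hp0, hxq', add_zero]
  rw [← hmax _ hQ fun p hp => ⟨p, hp, 0, h0, by ring⟩]
  exact ⟨0, h0, 1, h1, by ring⟩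

/-- Membership in a maximal partial ordering can be tested after multiplying by squares of
elements that have no common annihilator. -/
theorem IsMaxPartialOrderingOn.mem_of_sq_mul_mem {R : Type*} [CommRing R] [IsReduced R]
    {S : Subring R} {P : Set R} (hP : IsMaxPartialOrderingOn S P) {y : R} (hy : y ∈ S)
    (h : ∀ d ≠ 0, ∃ c ∈ S, c ^ 2 * y ∈ P ∧ c * d ≠ 0) : y ∈ P := by
  by_contra hyP
  obtain ⟨s, hs, hys, hne⟩ := hP.exists_neg_mul_mem hy hyP
  obtain ⟨c, hc, hcy, hcne⟩ := h _ hne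
  obtain ⟨-, -, hmul, hsq, hanti⟩ := hP.1
  have h0 : c ^ 2 * y * s = 0 := by
    refine hanti _ (hmul _ hcy _ hs) ?_
    rw [show -(c ^ 2 * y * s) = c ^ 2 * -(y * s) by ring]
    exact hmul _ (hsq c hc) _ hys
  refine hcne (eq_zero_of_pow_eq_zero (n := 2) ?_)
  linear_combination y * s * h0

theorem sq_mul_ne_zero_of_mul_ne_zero {R : Type*} [CommRing R] [IsReduced R] {a b : R}
    (h : a * b ≠ 0) : a ^ 2 * b ≠ 0 := fun h0 =>
  h (eq_zero_of_pow_eq_zero (n := 2) (by linear_combination b * h0))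

theorem IsPartialOrderingOn.inter {R : Type*} [CommRing R] {S : Subring R} {P : Set R}
    (hP : IsPartialOrderingOn (⊤ : Subring R) P) : IsPartialOrderingOn S (P ∩ ↑S) := by
  obtain ⟨-, hadd, hmul, hsq, hanti⟩ := hP
  exact ⟨fun _ hx => hx.2,
    fun x hx y hy => ⟨hadd x hx.1 y hy.1, S.add_mem hx.2 hy.2⟩,
    fun x hx y hy => ⟨hmul x hx.1 y hy.1, S.mul_mem hx.2 hy.2⟩,
    fun x hx => ⟨hsq x trivial, S.pow_mem hx 2⟩,
    fun x hx hnx => hanti x hx.1 hnx.1⟩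

section RationalExtension

variable {B : Type*} [CommRing B] {A : Subring B}

theorem exists_mul_mem_mul_mem_mul_ne_zero
    (hrat : ∀ b b' : B, b' ≠ 0 → ∃ a ∈ A, a * b ∈ A ∧ a * b' ≠ 0) (b c : B) {d : B}
    (hd : d ≠ 0) : ∃ a ∈ A, a * b ∈ A ∧ a * c ∈ A ∧ a * d ≠ 0 := by
  obtain ⟨a₁, h₁, hb, hd₁⟩ := hrat b d hd
  obtain ⟨a₂, h₂, hc, hd₂⟩ := hrat c _ hd₁
  refine ⟨a₁ * a₂, A.mul_mem h₁ h₂, ?_, ?_, ?_⟩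
  · rw [show a₁ * a₂ * b = a₂ * (a₁ * b) by ring]
    exact A.mul_mem h₂ hb
  · rw [mul_assoc]
    exact A.mul_mem h₁ hc
  · rwa [show a₁ * a₂ * d = a₂ * (a₁ * d) by ring]

/-- The set of those `b : B` whose multiples `a ^ 2 * b` lie in `P` whenever `a, a * b ∈ A`. -/
def partialOrderingExtension (A : Subring B) (P : Set B) : Set B :=
  {b | ∀ a ∈ A, a * b ∈ A → a ^ 2 * b ∈ P}

theorem partialOrderingExtension_inter {P : Set B} (hP : IsPartialOrderingOn A P) :
    partialOrderingExtension A P ∩ ↑A = P := by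
  ext b
  refine ⟨fun ⟨hb, hbA⟩ => ?_, fun hb => ⟨fun a ha _ => ?_, hP.1 hb⟩⟩
  · simpa using hb 1 A.one_mem (by simpa using hbA)
  · exact hP.2.2.1 _ (hP.2.2.2.1 a ha) _ hb

theorem subset_partialOrderingExtension {Q : Set B}
    (hQ : IsPartialOrderingOn (⊤ : Subring B) Q) :
    Q ⊆ partialOrderingExtension A (Q ∩ ↑A) := by
  intro b hb a ha hab
  refine ⟨hQ.2.2.1 _ (hQ.2.2.2.1 a trivial) _ hb, ?_⟩
  rw [show a ^ 2 * b = a * (a * b) by ring]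
  exact A.mul_mem ha hab

variable [IsReduced B]

theorem IsMaxPartialOrderingOn.extension_inter_eq
    (hrat : ∀ b b' : B, b' ≠ 0 → ∃ a ∈ A, a * b ∈ A ∧ a * b' ≠ 0) {P : Set B}
    (hP : IsMaxPartialOrderingOn (⊤ : Subring B) P) :
    partialOrderingExtension A (P ∩ ↑A) = P := by
  refine (subset_partialOrderingExtension hP.1).antisymm' fun b hb => ?_
  refine hP.mem_of_sq_mul_mem trivial fun d hd => ?_
  obtain ⟨a, ha, hab, had⟩ := hrat b d hd
  exact ⟨a, trivial, (hb a ha hab).1, had⟩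

theorem IsMaxPartialOrderingOn.inter
    (hrat : ∀ b b' : B, b' ≠ 0 → ∃ a ∈ A, a * b ∈ A ∧ a * b' ≠ 0) {P : Set B}
    (hP : IsMaxPartialOrderingOn (⊤ : Subring B) P) :
    IsMaxPartialOrderingOn A (P ∩ ↑A) := by
  refine ⟨hP.1.inter, fun Q hQ hPQ => hPQ.antisymm' fun x hx => ⟨?_, hQ.1 hx⟩⟩
  by_contra hxP
  obtain ⟨s, hs, hxs, hne⟩ := hP.exists_neg_mul_mem trivial hxP
  obtain ⟨a, ha, has, hane⟩ := hrat s _ hne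
  have hxA : x ∈ A := hQ.1 hx
  have hasA : a ^ 2 * s ∈ A := by
    rw [show a ^ 2 * s = a * (a * s) by ring]
    exact A.mul_mem ha has
  have hsq := hP.1.2.2.2.1 a trivial
  refine sq_mul_ne_zero_of_mul_ne_zero hane ?_
  rw [show a ^ 2 * (x * s) = x * (a ^ 2 * s) by ring]
  refine hQ.2.2.2.2 _ (hQ.2.2.1 _ hx _ (hPQ ⟨hP.1.2.2.1 _ hsq _ hs, hasA⟩)) (hPQ ⟨?_, ?_⟩)
  · rw [show -(x * (a ^ 2 * s)) = a ^ 2 * -(x * s) by ring]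
    exact hP.1.2.2.1 _ hsq _ hxs
  · exact A.neg_mem (A.mul_mem hxA hasA)

theorem IsMaxPartialOrderingOn.isPartialOrderingOn_extension
    (hrat : ∀ b b' : B, b' ≠ 0 → ∃ a ∈ A, a * b ∈ A ∧ a * b' ≠ 0) {P : Set B}
    (hP : IsMaxPartialOrderingOn A P) :
    IsPartialOrderingOn (⊤ : Subring B) (partialOrderingExtension A P) := by
  obtain ⟨-, hadd, hmul, hsq, hanti⟩ := hP.1
  have sq_mul_mem {a b : B} (ha : a ∈ A) (hab : a * b ∈ A) : a ^ 2 * b ∈ A := by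
    rw [show a ^ 2 * b = a * (a * b) by ring]
    exact A.mul_mem ha hab
  refine ⟨fun _ _ => trivial, fun b hb c hc a ha habc => ?_, fun b hb c hc a ha habc => ?_,
    fun b _ a ha hab => ?_, fun b hb hnb => ?_⟩
  · refine hP.mem_of_sq_mul_mem (sq_mul_mem ha habc) fun d hd => ?_
    obtain ⟨e, he, heb, hec, hed⟩ := exists_mul_mem_mul_mem_mul_ne_zero hrat b c hd
    refine ⟨e, he, ?_, hed⟩
    rw [show e ^ 2 * (a ^ 2 * (b + c)) = a ^ 2 * (e ^ 2 * b + e ^ 2 * c) by ring]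
    exact hmul _ (hsq a ha) _ (hadd _ (hb e he heb) _ (hc e he hec))
  · refine hP.mem_of_sq_mul_mem (sq_mul_mem ha habc) fun d hd => ?_
    obtain ⟨e, he, heb, hec, hed⟩ := exists_mul_mem_mul_mem_mul_ne_zero hrat b c hd
    refine ⟨e ^ 2, A.pow_mem he 2, ?_, sq_mul_ne_zero_of_mul_ne_zero hed⟩
    rw [show (e ^ 2) ^ 2 * (a ^ 2 * (b * c)) = a ^ 2 * (e ^ 2 * b * (e ^ 2 * c)) by ring]
    exact hmul _ (hsq a ha) _ (hmul _ (hb e he heb) _ (hc e he hec))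
  · refine hP.mem_of_sq_mul_mem (sq_mul_mem ha hab) fun d hd => ?_
    obtain ⟨e, he, heb, hed⟩ := hrat b d hd
    refine ⟨e, he, ?_, hed⟩
    rw [show e ^ 2 * (a ^ 2 * b ^ 2) = (a * (e * b)) ^ 2 by ring]
    exact hsq _ (A.mul_mem ha heb)
  · by_contra hne
    obtain ⟨a, ha, hab, habne⟩ := hrat b b hne
    refine sq_mul_ne_zero_of_mul_ne_zero habne (hanti _ (hb a ha hab) ?_)
    rw [← mul_neg]
    exact hnb a ha (by rw [mul_neg]; exact A.neg_mem hab)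

theorem IsMaxPartialOrderingOn.extension
    (hrat : ∀ b b' : B, b' ≠ 0 → ∃ a ∈ A, a * b ∈ A ∧ a * b' ≠ 0) {P : Set B}
    (hP : IsMaxPartialOrderingOn A P) :
    IsMaxPartialOrderingOn (⊤ : Subring B) (partialOrderingExtension A P) := by
  refine ⟨hP.isPartialOrderingOn_extension hrat, fun Q hQ hPQ => hPQ.antisymm' ?_⟩
  have hQA : Q ∩ ↑A = P := by
    refine hP.2 _ hQ.inter ?_
    rw [← partialOrderingExtension_inter hP.1]
    exact Set.inter_subset_inter_left _ hPQ
  rw [← hQA]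
  exact subset_partialOrderingExtension hQ

end RationalExtension

/-- Let `A` be a subring of a reduced commutative ring `B` such that `B` is a rational
extension of `A`. Then `P̃ ↦ P̃ ∩ A` is a bijection from the set of maximal partial
orderings of `B` onto the set of maximal partial orderings of `A`. -/
theorem bijOn_maxPartialOrdering_inter_subring {B : Type*} [CommRing B] [IsReduced B]
    (A : Subring B)
    (hrat : ∀ b b' : B, b' ≠ 0 → ∃ a ∈ A, a * b ∈ A ∧ a * b' ≠ 0) :
    Set.BijOn (fun P : Set B => P ∩ ↑A)
      {P : Set B | IsMaxPartialOrderingOn (⊤ : Subring B) P}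
      {Q : Set B | IsMaxPartialOrderingOn A Q} := by
  refine ⟨fun P hP => hP.inter hrat, fun P hP Q hQ hPQ => ?_, fun P hP =>
    ⟨_, hP.extension hrat, partialOrderingExtension_inter hP.1⟩⟩
  rw [← hP.extension_inter_eq hrat, ← hQ.extension_inter_eq hrat]
  exact congrArg (partialOrderingExtension A) hPQ
end

section
/- Let B be a reduced commutative von Neumann regular ring such that for every prime ideal p of B the residue ring B/p is a real closed field. Then every monic polynomial of odd degree in B[X] has a root in B. -/
/-- A commutative ring `K` is a real closed field if it is a field, `−1` is not a sum
of squares, every element or its negative is a square, and every polynomial of odd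
degree has a root. -/
def IsRealClosedField (K : Type*) [CommRing K] : Prop :=
  IsField K ∧
    (∀ (n : ℕ) (f : Fin n → K), (-1 : K) ≠ ∑ i, f i ^ 2) ∧
    (∀ x : K, (∃ y : K, x = y ^ 2) ∨ ∃ y : K, -x = y ^ 2) ∧
    ∀ f : Polynomial K, Odd f.natDegree → ∃ x : K, f.eval x = 0

/-- In a von Neumann regular ring, the elements annihilating some value of a polynomial `g`
form an ideal. -/
def polynomialValueAnnihilator {B : Type*} [CommRing B]
    (hvnr : ∀ x : B, ∃ y : B, x = x ^ 2 * y) (g : Polynomial B) : Ideal B where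
  carrier := {e | ∃ b : B, e * g.eval b = 0}
  zero_mem' := ⟨0, zero_mul _⟩
  smul_mem' := by
    rintro c e ⟨b, hb⟩
    exact ⟨b, by rw [smul_eq_mul, mul_assoc, hb, mul_zero]⟩
  add_mem' := by
    rintro e f ⟨b, hb⟩ ⟨c, hc⟩
    obtain ⟨y, hy⟩ := hvnr e
    set d := e * y * b + (1 - e * y) * c with hd
    obtain ⟨u, hu⟩ := g.sub_dvd_eval_sub d b
    obtain ⟨v, hv⟩ := g.sub_dvd_eval_sub d c
    have he : e * g.eval d = 0 := by
      linear_combination hb + e * hu + u * (c - b) * hy + e * u * hd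
    have hf : f * (1 - e * y) * g.eval d = 0 := by
      linear_combination (1 - e * y) * hc + f * (1 - e * y) * hv +
        f * v * (b - c) * y * hy + f * (1 - e * y) * v * hd
    exact ⟨d, by linear_combination (1 + f * y) * he + hf⟩

/-- Over a von Neumann regular ring, a polynomial with a root modulo every maximal ideal
has a root. -/
theorem exists_eval_eq_zero_of_forall_isMaximal {B : Type*} [CommRing B]
    (hvnr : ∀ x : B, ∃ y : B, x = x ^ 2 * y) (g : Polynomial B)
    (h : ∀ p : Ideal B, p.IsMaximal → ∃ b : B, g.eval b ∈ p) :
    ∃ b : B, g.eval b = 0 := by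
  suffices htop : polynomialValueAnnihilator hvnr g = ⊤ by
    obtain ⟨b, hb⟩ := (Ideal.eq_top_iff_one _).mp htop
    exact ⟨b, by rwa [one_mul] at hb⟩
  by_contra hne
  obtain ⟨p, hp, hle⟩ := Ideal.exists_le_maximal _ hne
  obtain ⟨b, hb⟩ := h p hp
  obtain ⟨y, hy⟩ := hvnr (g.eval b)
  have hmem : 1 - g.eval b * y ∈ p := hle ⟨b, by linear_combination hy⟩
  refine hp.ne_top ((Ideal.eq_top_iff_one p).mpr ?_)
  simpa using p.add_mem hmem (p.mul_mem_right y hb)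


/-- Let `B` be a reduced commutative von Neumann regular ring all of whose residue
rings at prime ideals are real closed fields.  Then every monic polynomial of odd
degree in `B[X]` has a root in `B`. -/
theorem monic_odd_degree_root_of_vonNeumannRegular {B : Type*} [CommRing B] [IsReduced B]
    (hvnr : ∀ x : B, ∃ y : B, x = x ^ 2 * y)
    (hrc : ∀ p : Ideal B, p.IsPrime → IsRealClosedField (B ⧸ p))
    (g : Polynomial B) (hg : g.Monic) (hodd : Odd g.natDegree) :
    ∃ b : B, g.eval b = 0 := by
  refine exists_eval_eq_zero_of_forall_isMaximal hvnr g fun p hp ↦ ?_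
  have : Nontrivial (B ⧸ p) := Ideal.Quotient.nontrivial_iff.mpr hp.ne_top
  obtain ⟨x, hx⟩ := (hrc p hp.isPrime).2.2.2 (g.map (Ideal.Quotient.mk p))
    (by rwa [hg.natDegree_map])
  obtain ⟨b, rfl⟩ := Ideal.Quotient.mk_surjective x
  refine ⟨b, Ideal.Quotient.eq_zero_iff_mem.mp ?_⟩
  rwa [Polynomial.eval_map_apply] at hx
end

section
/- Let B be a reduced commutative von Neumann regular ring such that for every prime ideal p of B the residue ring B/p is a real closed field, and let A be a subring of B that is integrally closed in B. Then for every prime ideal p of B, the quotient A/(p ∩ A) is an integral domain whose field of fractions is a real closed field. -/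
/-- If a domain is integrally closed in a real closed field containing it, then its field of
fractions is real closed. -/
theorem isRealClosedField_fractionRing {D K : Type*} [CommRing D] [IsDomain D] [Field K]
    [Algebra D K] [FaithfulSMul D K]
    (hint : ∀ x : K, IsIntegral D x → ∃ d : D, algebraMap D K d = x)
    (hK : IsRealClosedField K) : IsRealClosedField (FractionRing D) := by
  let : Algebra (FractionRing D) K := FractionRing.liftAlgebra D K
  have : IsScalarTower D (FractionRing D) K := FractionRing.isScalarTower_liftAlgebra D K
  have hinj : Function.Injective (algebraMap (FractionRing D) K) :=
    (algebraMap (FractionRing D) K).injective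
  have halg : ∀ x : K, IsAlgebraic (FractionRing D) x →
      ∃ y : FractionRing D, algebraMap (FractionRing D) K y = x := by
    intro x hx
    have hx' : IsAlgebraic D x := (IsFractionRing.isAlgebraic_iff D (FractionRing D) K).2 hx
    obtain ⟨d, hd, hdx⟩ := hx'.exists_integral_multiple
    obtain ⟨a, ha⟩ := hint _ hdx
    have hd' : algebraMap D K d ≠ 0 := by
      simpa using hd
    refine ⟨algebraMap D _ a / algebraMap D _ d, ?_⟩
    rw [map_div₀, ← IsScalarTower.algebraMap_apply, ← IsScalarTower.algebraMap_apply, ha,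
      Algebra.smul_def, mul_div_cancel_left₀ _ hd']
  have hsq : ∀ (x : FractionRing D) (y : K), algebraMap (FractionRing D) K x = y ^ 2 →
      ∃ z : FractionRing D, x = z ^ 2 := by
    intro x y hxy
    have hy : IsAlgebraic (FractionRing D) y :=
      IsAlgebraic.of_pow two_pos (hxy ▸ isAlgebraic_algebraMap x)
    obtain ⟨z, rfl⟩ := halg y hy
    exact ⟨z, hinj (by rw [hxy, map_pow])⟩
  obtain ⟨-, hsum, hsquare, hodd⟩ := hK
  refine ⟨Field.toIsField _, fun n f h => ?_, fun x => ?_, fun f hf => ?_⟩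
  · exact hsum n (fun i => algebraMap (FractionRing D) K (f i)) (by
      simpa using congrArg (algebraMap (FractionRing D) K) h)
  · rcases hsquare (algebraMap (FractionRing D) K x) with ⟨y, hy⟩ | ⟨y, hy⟩
    · exact Or.inl (hsq x y hy)
    · exact Or.inr (hsq (-x) y (by rw [map_neg, hy]))
  · obtain ⟨x, hx⟩ := hodd (f.map (algebraMap (FractionRing D) K))
      (by rwa [Polynomial.natDegree_map])
    have hf0 : f ≠ 0 := by
      rintro rfl
      simp at hf
    obtain ⟨y, rfl⟩ := halg x ⟨f, hf0, by rwa [Polynomial.aeval_def, ← Polynomial.eval_map]⟩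
    refine ⟨y, hinj ?_⟩
    rw [map_zero, ← hx, Polynomial.eval_map_apply]

/-- In a von Neumann regular ring, an element that is a root of a monic polynomial over an
integrally closed subring modulo an ideal is congruent modulo that ideal to an element of the
subring. -/
theorem exists_mem_sub_mem_of_eval_mem {B : Type*} [CommRing B]
    (hvnr : ∀ x : B, ∃ y : B, x = x ^ 2 * y) (A : Subring B)
    (hic : ∀ b : B,
      (∃ f : Polynomial B, f.Monic ∧ (∀ i, f.coeff i ∈ A) ∧ f.eval b = 0) → b ∈ A)
    (I : Ideal B) (f : Polynomial B) (hf : f.Monic) (hfA : ∀ i, f.coeff i ∈ A) (b : B)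
    (hb : f.eval b ∈ I) : ∃ a ∈ A, a - b ∈ I := by
  obtain ⟨y, hy⟩ := hvnr (f.eval b)
  refine ⟨b - f.eval b * y * b, hic _ ⟨Polynomial.X * f, Polynomial.monic_X.mul hf, ?_, ?_⟩, ?_⟩
  · rintro (_ | i)
    · simp
    · simpa [Polynomial.coeff_X_mul] using hfA i
  · obtain ⟨t, ht⟩ := Polynomial.sub_dvd_eval_sub (b - f.eval b * y * b) b f
    rw [Polynomial.eval_mul, Polynomial.eval_X]
    generalize f.eval (b - f.eval b * y * b) = u at ht ⊢
    generalize f.eval b = c at hy ht ⊢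
    obtain rfl : u = c + (b - c * y * b - b) * t := by rw [← ht]; ring
    linear_combination (b - b ^ 2 * y * t) * hy
  · have : b - f.eval b * y * b - b = -(y * b) * f.eval b := by ring
    rw [this]
    exact I.mul_mem_left _ hb

/-- Let `B` be a reduced commutative von Neumann regular ring all of whose residue
rings at prime ideals are real closed fields, and let `A` be a subring of `B`
integrally closed in `B`.  Then for every prime ideal `p` of `B`, the quotient
`A/(p ∩ A)` is an integral domain whose field of fractions is a real closed field. -/
theorem quotient_fractionField_realClosed {B : Type*} [CommRing B] [IsReduced B]
    (hvnr : ∀ x : B, ∃ y : B, x = x ^ 2 * y)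
    (hrc : ∀ p : Ideal B, p.IsPrime → IsRealClosedField (B ⧸ p))
    (A : Subring B)
    (hic : ∀ b : B,
      (∃ f : Polynomial B, f.Monic ∧ (∀ i, f.coeff i ∈ A) ∧ f.eval b = 0) → b ∈ A)
    (p : Ideal B) (hp : p.IsPrime) :
    IsDomain (↥A ⧸ Ideal.comap A.subtype p) ∧
      IsRealClosedField (FractionRing (↥A ⧸ Ideal.comap A.subtype p)) := by
  have : IsDomain (↥A ⧸ Ideal.comap A.subtype p) := Ideal.Quotient.isDomain _
  refine ⟨inferInstance, ?_⟩
  let : Field (B ⧸ p) := (hrc p hp).1.toField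
  let φ : (↥A ⧸ Ideal.comap A.subtype p) →+* B ⧸ p := Ideal.quotientMap p A.subtype le_rfl
  let : Algebra (↥A ⧸ Ideal.comap A.subtype p) (B ⧸ p) := φ.toAlgebra
  have : FaithfulSMul (↥A ⧸ Ideal.comap A.subtype p) (B ⧸ p) :=
    (faithfulSMul_iff_algebraMap_injective _ _).2 Ideal.quotientMap_injective
  refine isRealClosedField_fractionRing (K := B ⧸ p) ?_ (hrc p hp)
  rintro x ⟨q, hq, hqx⟩
  obtain ⟨b, rfl⟩ := Ideal.Quotient.mk_surjective x
  obtain ⟨f, rfl, -, hf⟩ := Polynomial.lifts_and_degree_eq_and_monic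
    ((Polynomial.mem_lifts q).2
      (Polynomial.map_surjective _ Ideal.Quotient.mk_surjective q)) hq
  have hb : (f.map A.subtype).eval b ∈ p := by
    rw [← Ideal.Quotient.eq_zero_iff_mem, ← hqx, Polynomial.eval₂_map, Polynomial.eval_map,
      Polynomial.hom_eval₂]
    rfl
  obtain ⟨a, ha, hab⟩ := exists_mem_sub_mem_of_eval_mem hvnr A hic p (f.map A.subtype)
    (hf.map _) (fun i => by simp) b hb
  exact ⟨Ideal.Quotient.mk _ ⟨a, ha⟩, Ideal.Quotient.eq.2 hab⟩
end

section
/- Let A be a reduced commutative ring whose total quotient ring T(A) is von Neumann regular. Then for every prime ideal p of T(A), the quotient T(A)/p is a field, the canonical ring homomorphism A/(p ∩ A) → T(A)/p is injective, and every element of T(A)/p is a quotient of images of elements of A/(p ∩ A); that is, T(A)/p is the field of fractions of A/(p ∩ A). -/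
/-- Let `A` be a reduced commutative ring whose total quotient ring `T(A)`
(= `FractionRing A`, the localization at the non-zero-divisors) is von Neumann
regular.  Then for every prime ideal `p` of `T(A)`: `T(A)/p` is a field, the
canonical map `A/(p ∩ A) → T(A)/p` is injective, and every element of `T(A)/p` is a
quotient of images of elements of `A/(p ∩ A)`; i.e. `T(A)/p` is the field of
fractions of `A/(p ∩ A)`. -/
theorem totalQuotientRing_quotient_is_fractionField {A : Type*} [CommRing A] [IsReduced A]
    (hvnr : ∀ x : FractionRing A, ∃ y : FractionRing A, x = x ^ 2 * y)
    (p : Ideal (FractionRing A)) (hp : p.IsPrime) :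
    IsField (FractionRing A ⧸ p) ∧
      Function.Injective
        (Ideal.quotientMap p (algebraMap A (FractionRing A)) le_rfl) ∧
      ∀ z : FractionRing A ⧸ p, ∃ x y : A,
        ((Ideal.Quotient.mk p).comp (algebraMap A (FractionRing A))) y ≠ 0 ∧
        z * ((Ideal.Quotient.mk p).comp (algebraMap A (FractionRing A))) y =
          ((Ideal.Quotient.mk p).comp (algebraMap A (FractionRing A))) x := by
  refine ⟨?_, Ideal.quotientMap_injective, fun z => ?_⟩
  · refine ⟨exists_pair_ne _, mul_comm, fun {a} ha => ?_⟩
    obtain ⟨x, rfl⟩ := Ideal.Quotient.mk_surjective a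
    obtain ⟨y, hy⟩ := hvnr x
    refine ⟨Ideal.Quotient.mk p y, mul_left_cancel₀ ha ?_⟩
    rw [← map_mul, ← map_mul, mul_one, ← mul_assoc, ← pow_two, ← hy]
  · obtain ⟨t, rfl⟩ := Ideal.Quotient.mk_surjective z
    obtain ⟨⟨x, s⟩, h⟩ := IsLocalization.surj (nonZeroDivisors A) t
    refine ⟨x, s, ?_, ?_⟩
    · exact ((IsLocalization.map_units (FractionRing A) s).map (Ideal.Quotient.mk p)).ne_zero
    · simp only [RingHom.comp_apply, ← map_mul, h]
end

section
/- Let B be a reduced commutative von Neumann regular ring such that for every prime ideal p of B the residue ring B/p is a real closed field, let A be a subring of B that is integrally closed in B, and let T be an intermediate ring A ⊆ T ⊆ B such that T is von Neumann regular and every element t ∈ T satisfies t·s ∈ A for some non-zero-divisor s of A that is invertible in T. Then for every prime ideal q of T, the residue ring T/q is a real closed field. -/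
section

open Polynomial

/-- In a von Neumann regular ring, a polynomial with a root modulo every prime ideal has a root. -/
theorem exists_eval_eq_zero_of_forall_isPrime {B : Type*} [CommRing B]
    (hvnr : ∀ x : B, ∃ y : B, x = x ^ 2 * y) (F : B[X])
    (hF : ∀ p : Ideal B, p.IsPrime → ∃ b : B, F.eval b ∈ p) : ∃ b : B, F.eval b = 0 := by
  let I : Ideal B :=
    { carrier := {e | ∃ b, e * F.eval b = 0}
      zero_mem' := ⟨0, zero_mul _⟩
      smul_mem' := by
        rintro c e ⟨b, hb⟩
        exact ⟨b, by rw [smul_eq_mul, mul_assoc, hb, mul_zero]⟩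
      add_mem' := by
        rintro d e ⟨b, hb⟩ ⟨c, hc⟩
        obtain ⟨y, hy⟩ := hvnr d
        refine ⟨d * y * b + (1 - d * y) * c, ?_⟩
        obtain ⟨k, hk⟩ := F.sub_dvd_eval_sub (d * y * b + (1 - d * y) * c) b
        obtain ⟨l, hl⟩ := F.sub_dvd_eval_sub (d * y * b + (1 - d * y) * c) c
        have hd : d * F.eval (d * y * b + (1 - d * y) * c) = 0 := by
          linear_combination d * hk + hb + (c - b) * k * hy
        linear_combination hd + e * y * hd + (1 - d * y) * hc + e * (1 - d * y) * hl
          + e * y * (b - c) * l * hy }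
  have hI : I = ⊤ := by
    by_contra h
    obtain ⟨m, hm, hIm⟩ := I.exists_le_maximal h
    obtain ⟨b, hb⟩ := hF m hm.isPrime
    obtain ⟨y, hy⟩ := hvnr (F.eval b)
    have h1 : 1 - F.eval b * y ∈ m := hIm ⟨b, by linear_combination hy⟩
    refine hm.ne_top ((Ideal.eq_top_iff_one m).2 ?_)
    simpa using m.add_mem h1 (m.mul_mem_right y hb)
  obtain ⟨b, hb⟩ := (Ideal.eq_top_iff_one I).1 hI
  exact ⟨b, by simpa using hb⟩

/-- A subring all of whose elements are fractions over `A` with denominators invertible in it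
admits common denominators. -/
theorem Subring.exists_common_denominator {B : Type*} [CommRing B] (A T : Subring B)
    (hT : ∀ t ∈ T, ∃ s ∈ A, (∃ u ∈ T, s * u = 1) ∧ t * s ∈ A)
    (S : Finset B) (hS : ∀ t ∈ S, t ∈ T) :
    ∃ s ∈ A, (∃ u ∈ T, s * u = 1) ∧ ∀ t ∈ S, t * s ∈ A := by
  classical
  induction S using Finset.induction_on with
  | empty => exact ⟨1, A.one_mem, ⟨1, T.one_mem, mul_one 1⟩, by simp⟩
  | insert t S _ ih =>
    obtain ⟨s, hs, ⟨u, hu, hsu⟩, hsS⟩ := ih fun x hx => hS x (Finset.mem_insert_of_mem hx)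
    obtain ⟨r, hr, ⟨v, hv, hrv⟩, hrt⟩ := hT t (hS t (Finset.mem_insert_self t S))
    refine ⟨s * r, A.mul_mem hs hr, ⟨u * v, T.mul_mem hu hv, ?_⟩, fun x hx => ?_⟩
    · linear_combination r * v * hsu + hrv
    · rcases Finset.mem_insert.1 hx with rfl | hx
      · simpa only [mul_comm, mul_left_comm] using A.mul_mem hs hrt
      · simpa only [mul_assoc] using A.mul_mem (hsS x hx) hr

/-- If `A` is integrally closed in `B`, then so is any intermediate ring of fractions of `A`. -/
theorem Subring.mem_of_monic_of_fractions {B : Type*} [CommRing B] (A T : Subring B)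
    (hAT : A ≤ T)
    (hA : ∀ b : B, (∃ f : B[X], f.Monic ∧ (∀ i, f.coeff i ∈ A) ∧ f.eval b = 0) → b ∈ A)
    (hT : ∀ t ∈ T, ∃ s ∈ A, (∃ u ∈ T, s * u = 1) ∧ t * s ∈ A)
    {b : B} {f : B[X]} (hf : f.Monic) (hfT : ∀ i, f.coeff i ∈ T) (hb : f.eval b = 0) :
    b ∈ T := by
  classical
  obtain ⟨s, hs, ⟨u, hu, hsu⟩, hsf⟩ := Subring.exists_common_denominator A T hT
    (f.support.image f.coeff) (by
      intro t ht
      obtain ⟨i, -, rfl⟩ := Finset.mem_image.1 ht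
      exact hfT i)
  have hsb : s * b ∈ A := by
    refine hA _ ⟨f.scaleRoots s, (monic_scaleRoots_iff s).2 hf, fun i => ?_, ?_⟩
    · rw [coeff_scaleRoots]
      by_cases h0 : f.coeff i = 0
      · simp [h0]
      rcases (le_natDegree_of_ne_zero h0).eq_or_lt with rfl | hi
      · simp [hf.coeff_natDegree]
      · obtain ⟨k, hk⟩ := Nat.exists_eq_add_of_lt hi
        rw [show f.natDegree - i = k + 1 by omega, pow_succ', ← mul_assoc]
        exact A.mul_mem (hsf _ (Finset.mem_image_of_mem _ (mem_support_iff.2 h0)))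
          (A.pow_mem hs k)
    · have h := scaleRoots_eval₂_eq_zero (p := f) (RingHom.id B) (r := b) (s := s) hb
      simpa [eval₂_id] using h
  rw [show b = u * (s * b) by linear_combination -b * hsu]
  exact T.mul_mem hu (hAT hsb)

/-- A quotient of a von Neumann regular ring by a prime ideal is a field. -/
theorem isField_quotient_of_vonNeumannRegular {T : Type*} [CommRing T]
    (hT : ∀ t : T, ∃ u : T, t = t ^ 2 * u) (q : Ideal T) [q.IsPrime] : IsField (T ⧸ q) where
  exists_pair_ne := ⟨0, 1, zero_ne_one⟩
  mul_comm := mul_comm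
  mul_inv_cancel := by
    intro a ha
    obtain ⟨t, rfl⟩ := Ideal.Quotient.mk_surjective a
    obtain ⟨u, hu⟩ := hT t
    have h := congrArg (Ideal.Quotient.mk q) hu
    rw [map_mul, map_pow] at h
    exact ⟨Ideal.Quotient.mk q u, mul_left_cancel₀ ha (by linear_combination -h)⟩

end

/-- Let `B` be a reduced commutative von Neumann regular ring all of whose residue
rings at prime ideals are real closed fields, let `A ⊆ B` be a subring integrally
closed in `B`, and let `T` be an intermediate ring `A ⊆ T ⊆ B` which is von Neumann
regular and such that every `t ∈ T` satisfies `t·s ∈ A` for some non-zero-divisor `s`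
of `A` that is invertible in `T`.  Then for every prime ideal `q` of `T`, the residue
ring `T/q` is a real closed field. -/
theorem intermediate_totalQuotient_residue_realClosed {B : Type*} [CommRing B] [IsReduced B]
    (hvnr : ∀ x : B, ∃ y : B, x = x ^ 2 * y)
    (hrc : ∀ p : Ideal B, p.IsPrime → IsRealClosedField (B ⧸ p))
    (A T : Subring B) (hAT : A ≤ T)
    (hic : ∀ b : B,
      (∃ f : Polynomial B, f.Monic ∧ (∀ i, f.coeff i ∈ A) ∧ f.eval b = 0) → b ∈ A)
    (hTvnr : ∀ t : ↥T, ∃ u : ↥T, t = t ^ 2 * u)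
    (hTfrac : ∀ t ∈ T, ∃ s ∈ A, (∀ a ∈ A, s * a = 0 → a = 0) ∧
      (∃ u ∈ T, s * u = 1) ∧ t * s ∈ A)
    (q : Ideal ↥T) (hq : q.IsPrime) :
    IsRealClosedField (↥T ⧸ q) := by
  have hroot (F : Polynomial T) (hF : F.Monic)
      (h : ∀ p : Ideal B, p.IsPrime →
        ∃ c : B ⧸ p, (F.map ((Ideal.Quotient.mk p).comp T.subtype)).eval c = 0) :
      ∃ t : T, F.eval t = 0 := by
    obtain ⟨b, hb⟩ := exists_eval_eq_zero_of_forall_isPrime hvnr (F.map T.subtype) (by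
      intro p hp
      obtain ⟨c, hc⟩ := h p hp
      obtain ⟨b, rfl⟩ := Ideal.Quotient.mk_surjective c
      refine ⟨b, Ideal.Quotient.eq_zero_iff_mem.1 ?_⟩
      rwa [← Polynomial.map_map, Polynomial.eval_map_apply] at hc)
    have hbT : b ∈ T := Subring.mem_of_monic_of_fractions A T hAT hic
      (fun t ht => by
        obtain ⟨s, hs, -, h⟩ := hTfrac t ht
        exact ⟨s, hs, h⟩)
      (hF.map T.subtype) (fun i => by simp) hb
    refine ⟨⟨b, hbT⟩, T.subtype_injective ?_⟩
    rw [map_zero, ← hb, ← Polynomial.eval_map_apply]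
    rfl
  have hfield := isField_quotient_of_vonNeumannRegular hTvnr q
  refine ⟨hfield, fun n f hf => ?_, fun x => ?_, fun f hf => ?_⟩
  · choose g hg using fun i => Ideal.Quotient.mk_surjective (f i)
    set a : T := 1 + ∑ i, g i ^ 2 with ha
    have haq : a ∈ q := by
      rw [← Ideal.Quotient.eq_zero_iff_mem, ha, map_add, map_one, map_sum]
      simp only [map_pow, hg, ← hf]
      exact add_neg_cancel 1
    have hunit : IsUnit (a : B) := by
      by_contra h
      obtain ⟨m, hm, ham⟩ := exists_max_ideal_of_mem_nonunits h
      refine (hrc m hm.isPrime).2.1 n (fun i => Ideal.Quotient.mk m (g i)) ?_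
      have h0 := Ideal.Quotient.eq_zero_iff_mem.2 ham
      simp only [ha, Subring.coe_add, Subring.coe_one, AddSubmonoidClass.coe_finsetSum,
        Subring.coe_pow, map_add, map_one, map_sum, map_pow] at h0
      linear_combination -h0
    obtain ⟨u, hu⟩ := hTvnr a
    have hau : a * u = 1 := by
      refine T.subtype_injective (hunit.mul_left_cancel ?_)
      have := congrArg T.subtype hu
      simp only [map_mul, map_pow, map_one, Subring.subtype_apply] at this ⊢
      linear_combination -this
    exact hq.ne_top ((Ideal.eq_top_iff_one q).2 (hau ▸ q.mul_mem_right u haq))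
  · obtain ⟨t, rfl⟩ := Ideal.Quotient.mk_surjective x
    obtain ⟨y, hy⟩ := hroot (Polynomial.X ^ 4 - Polynomial.C (t ^ 2))
      (Polynomial.monic_X_pow_sub_C _ (by norm_num)) (by
        intro p hp
        rcases (hrc p hp).2.2.1 (Ideal.Quotient.mk p t) with ⟨c, hc⟩ | ⟨c, hc⟩ <;>
          refine ⟨c, ?_⟩ <;>
          simp only [Polynomial.map_sub, Polynomial.map_pow, Polynomial.map_X, Polynomial.map_C,
            Polynomial.eval_sub, Polynomial.eval_pow, Polynomial.eval_X, Polynomial.eval_C,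
            map_pow, RingHom.comp_apply, Subring.subtype_apply]
        · linear_combination (-c ^ 2 - Ideal.Quotient.mk p (t : B)) * hc
        · linear_combination (-c ^ 2 + Ideal.Quotient.mk p (t : B)) * hc)
    simp only [Polynomial.eval_sub, Polynomial.eval_pow, Polynomial.eval_X,
      Polynomial.eval_C] at hy
    have h := congrArg (Ideal.Quotient.mk q) hy
    simp only [map_sub, map_pow, map_zero] at h
    have hmul : (Ideal.Quotient.mk q t - Ideal.Quotient.mk q y ^ 2) *
        (-Ideal.Quotient.mk q t - Ideal.Quotient.mk q y ^ 2) = 0 := by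
      linear_combination h
    exact (mul_eq_zero.1 hmul).imp (fun h => ⟨_, sub_eq_zero.1 h⟩) fun h => ⟨_, sub_eq_zero.1 h⟩
  · have hf0 : f.leadingCoeff ≠ 0 := by
      rw [Polynomial.leadingCoeff_ne_zero]
      rintro rfl
      simp at hf
    obtain ⟨c, hc⟩ := hfield.mul_inv_cancel hf0
    have hmonic : (f * Polynomial.C c).Monic := Polynomial.monic_mul_C_of_leadingCoeff_mul_eq_one hc
    have hc0 : c ≠ 0 := right_ne_zero_of_mul (hc ▸ one_ne_zero)
    obtain ⟨F, hFmap, hFdeg, hF⟩ := Polynomial.lifts_and_natDegree_eq_and_monic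
      (Polynomial.map_surjective _ Ideal.Quotient.mk_surjective (f * Polynomial.C c)) hmonic
    obtain ⟨t, ht⟩ := hroot F hF (by
      intro p hp
      refine (hrc p hp).2.2.2 _ ?_
      rwa [hF.natDegree_map, hFdeg, Polynomial.natDegree_mul_C hc0])
    refine ⟨Ideal.Quotient.mk q t, ?_⟩
    have h := Polynomial.eval_map_apply (Ideal.Quotient.mk q) (p := F) t
    rw [hFmap, ht, map_zero, Polynomial.eval_mul, Polynomial.eval_C] at h
    exact (mul_eq_zero.1 h).resolve_right hc0
end

section
/- Let A be a reduced commutative Baer ring. Then the total quotient ring T(A) of A is von Neumann regular. -/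
/-- In a reduced ring, if `e` generates the annihilator of `a` and is idempotent, then `a + e`
is a non-zero-divisor. -/
theorem add_mem_nonZeroDivisors_of_annihilator {A : Type*} [CommRing A] [IsReduced A] {a e : A}
    (he : e * e = e) (hae : e * a = 0) (hann : ∀ z : A, z * a = 0 → ∃ b, z = e * b) :
    a + e ∈ nonZeroDivisors A := by
  rw [mem_nonZeroDivisors_iff_right]
  intro z hz
  have hza : z * a = 0 := by
    refine (pow_eq_zero_iff two_ne_zero).mp ?_
    linear_combination z * a * hz - z ^ 2 * hae
  obtain ⟨b, rfl⟩ := hann z hza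
  linear_combination hz - hza - b * he

/-- Let `A` be a reduced commutative Baer ring (for every ideal `I` of `A` the
annihilator of `I` is generated by an idempotent).  Then the total quotient ring
`T(A)` (= `FractionRing A`, the localization at the non-zero-divisors) is von
Neumann regular. -/
theorem totalQuotientRing_vonNeumannRegular_of_baer {A : Type*} [CommRing A] [IsReduced A]
    (hBaer : ∀ I : Ideal A, ∃ e : A, e * e = e ∧
      ∀ x : A, (∀ y ∈ I, x * y = 0) ↔ ∃ a : A, x = e * a) :
    ∀ x : FractionRing A, ∃ y : FractionRing A, x = x ^ 2 * y := by
  intro x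
  obtain ⟨a, s, rfl⟩ := IsLocalization.exists_mk'_eq (nonZeroDivisors A) x
  obtain ⟨e, he, hann⟩ := hBaer (Ideal.span {a})
  have hea : e * a = 0 := (hann e).mpr ⟨e, he.symm⟩ a (Ideal.mem_span_singleton_self a)
  have hreg : a + e ∈ nonZeroDivisors A := by
    refine add_mem_nonZeroDivisors_of_annihilator he hea fun z hz ↦ (hann z).mp fun y hy ↦ ?_
    obtain ⟨c, rfl⟩ := Ideal.mem_span_singleton'.mp hy
    linear_combination c * hz
  refine ⟨IsLocalization.mk' _ (s : A) ⟨a + e, hreg⟩, ?_⟩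
  rw [sq, ← IsLocalization.mk'_mul, ← IsLocalization.mk'_mul]
  refine IsLocalization.mk'_eq_of_eq ?_
  push_cast
  linear_combination -(s : A) * s * hea
end

section
/- Let A be a reduced commutative Baer ring with total quotient ring T(A). Then A is integrally closed in T(A) if and only if for every prime ideal p of T(A), the image of A/(p ∩ A) in T(A)/p is integrally closed in T(A)/p. -/
open Polynomial nonZeroDivisors

/-- In a ring where annihilators of principal ideals are generated by idempotents, the total
quotient ring is von Neumann regular. -/
theorem FractionRing.exists_mul_mul_eq_self {A : Type*} [CommRing A]
    (h : ∀ a : A, ∃ e : A, e * e = e ∧ ∀ x : A, x * a = 0 ↔ ∃ b : A, x = e * b)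
    (y : FractionRing A) : ∃ t, y * t * y = y := by
  obtain ⟨a, s, rfl⟩ := IsLocalization.exists_mk'_eq A⁰ y
  obtain ⟨e, he, hann⟩ := h a
  have hea : e * a = 0 := (hann e).2 ⟨1, by ring⟩
  have hc : a + e ∈ A⁰ := by
    rw [mem_nonZeroDivisors_iff_right]
    intro b hb
    have heb : e * b = 0 := by linear_combination e * hb - b * hea - b * he
    obtain ⟨d, rfl⟩ := (hann b).1 (by linear_combination hb - heb)
    linear_combination heb - d * he
  refine ⟨IsLocalization.mk' _ (s : A) (⟨a + e, hc⟩ : A⁰), ?_⟩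
  rw [← IsLocalization.mk'_mul, ← IsLocalization.mk'_mul, IsLocalization.mk'_eq_iff_eq]
  congr 1
  simp only [Submonoid.coe_mul]
  linear_combination (-(s : A) * s) * hea

/-- In a ring where annihilators of principal ideals are generated by idempotents, the idempotents
of the total quotient ring come from the ring itself. -/
theorem FractionRing.idempotent_mem_range {A : Type*} [CommRing A]
    (h : ∀ a : A, ∃ e : A, e * e = e ∧ ∀ x : A, x * a = 0 ↔ ∃ b : A, x = e * b)
    {u : FractionRing A} (hu : u * u = u) : u ∈ (algebraMap A (FractionRing A)).range := by
  obtain ⟨a, s, rfl⟩ := IsLocalization.exists_mk'_eq A⁰ u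
  obtain ⟨e, he, hann⟩ := h a
  have hea : e * a = 0 := (hann e).2 ⟨1, by ring⟩
  have hinj := IsLocalization.injective (FractionRing A) (le_refl A⁰)
  have hsq : (a - s) * a = 0 := by
    apply hinj
    have hs := IsLocalization.mk'_spec (FractionRing A) a s
    rw [map_mul, map_sub, map_zero, ← hs]
    linear_combination (algebraMap A (FractionRing A) s) ^ 2 * hu
  obtain ⟨d, hd⟩ := (hann _).1 hsq
  refine ⟨1 - e, ?_⟩
  rw [eq_comm, IsLocalization.mk'_eq_iff_eq_mul, ← map_mul]
  congr 1
  linear_combination (1 - e) * hd + hea - d * he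

/-- If `x` is modulo every prime `p` congruent to an element of a subring containing all
idempotents of a von Neumann regular ring, then `x` lies in that subring. -/
theorem Subring.mem_of_forall_isPrime_sub_mem {T : Type*} [CommRing T] (R : Subring T)
    (hreg : ∀ y : T, ∃ t, y * t * y = y) (hidem : ∀ u : T, u * u = u → u ∈ R) {x : T}
    (hx : ∀ p : Ideal T, p.IsPrime → ∃ a ∈ R, x - a ∈ p) : x ∈ R := by
  let D : Ideal T :=
    { carrier := {t | ∃ u : T, u * u = u ∧ u * x ∈ R ∧ t * u = t}
      zero_mem' := ⟨0, by simp, by simp, by simp⟩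
      add_mem' := by
        rintro s t ⟨u, hu, hux, hs⟩ ⟨v, hv, hvx, ht⟩
        refine ⟨u + v - u * v, ?_, ?_, ?_⟩
        · linear_combination (1 - 2 * v + v * v) * hu + (1 - u) * hv
        · have : (u + v - u * v) * x = u * x + v * x - u * (v * x) := by ring
          rw [this]
          exact R.sub_mem (R.add_mem hux hvx) (R.mul_mem (hidem u hu) hvx)
        · linear_combination (1 - v) * hs + (1 - u) * ht
      smul_mem' := by
        rintro c t ⟨u, hu, hux, ht⟩
        refine ⟨u, hu, hux, ?_⟩
        rw [smul_eq_mul, mul_assoc, ht] }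
  by_cases hD : D = ⊤
  · obtain ⟨u, -, hux, h1⟩ : (1 : T) ∈ D := hD ▸ Submodule.mem_top
    rw [one_mul] at h1
    simpa [h1] using hux
  · obtain ⟨p, hp, hDp⟩ := Ideal.exists_le_maximal D hD
    obtain ⟨a, ha, hxa⟩ := hx p hp.isPrime
    obtain ⟨t, ht⟩ := hreg (x - a)
    have he : (x - a) * t ∈ p := p.mul_mem_right t hxa
    have hu : (1 - (x - a) * t) * (1 - (x - a) * t) = 1 - (x - a) * t := by
      linear_combination t * ht
    have hmem : 1 - (x - a) * t ∈ D := by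
      refine ⟨_, hu, ?_, hu⟩
      have : (1 - (x - a) * t) * x = (1 - (x - a) * t) * a := by linear_combination -ht
      rw [this]
      exact R.mul_mem (hidem _ hu) ha
    exact absurd (p.eq_top_iff_one.2 (by simpa using p.add_mem (hDp hmem) he)) hp.ne_top

/-- In a von Neumann regular `A`-algebra, an element integral over `A` modulo an ideal is congruent
to an integral element. -/
theorem exists_isIntegral_sub_mem {A T : Type*} [CommRing A] [CommRing T] [Algebra A T]
    (hreg : ∀ y : T, ∃ t, y * t * y = y) {p : Ideal T} {x : T} {f : A[X]} (hf : f.Monic)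
    (hx : aeval x f ∈ p) : ∃ w : T, IsIntegral A w ∧ x - w ∈ p := by
  obtain ⟨t, ht⟩ := hreg (aeval x f)
  set e := aeval x f * t with he
  have hep : e ∈ p := p.mul_mem_right t hx
  have hee : e * e = e := by rw [he]; linear_combination t * ht
  refine ⟨(1 - e) * x, ⟨X * f, monic_X.mul hf, ?_⟩, ?_⟩
  · rw [← aeval_def, map_mul, aeval_X]
    obtain ⟨d, hd⟩ := (f.map (algebraMap A T)).sub_dvd_eval_sub ((1 - e) * x) x
    rw [eval_map_algebraMap, eval_map_algebraMap] at hd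
    linear_combination (1 - e) * x * hd - x * ht + x ^ 2 * d * hee
  · have : x - (1 - e) * x = e * x := by ring
    rw [this]
    exact p.mul_mem_right x hep

/-- A monic polynomial with coefficients in the range of a ring homomorphism lifts to a monic
polynomial. -/
theorem Polynomial.Monic.exists_monic_map_eq {R S : Type*} [CommRing R] [CommRing S] {φ : R →+* S}
    {g : S[X]} (hg : g.Monic) (hcoeff : ∀ i, g.coeff i ∈ φ.range) :
    ∃ f : R[X], f.Monic ∧ f.map φ = g := by
  obtain ⟨f, hf, -, hfm⟩ := lifts_and_natDegree_eq_and_monic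
    ((lifts_iff_coeff_lifts g).2 hcoeff) hg
  exact ⟨f, hfm, hf⟩


/-- Let `A` be a reduced commutative Baer ring with total quotient ring
`T(A) = FractionRing A`.  Then `A` is integrally closed in `T(A)` iff for every prime
ideal `p` of `T(A)`, the image of `A/(p ∩ A)` in `T(A)/p` is integrally closed in
`T(A)/p`. -/
theorem baer_integrallyClosed_iff_quotients {A : Type*} [CommRing A] [IsReduced A]
    (hBaer : ∀ I : Ideal A, ∃ e : A, e * e = e ∧
      ∀ x : A, (∀ y ∈ I, x * y = 0) ↔ ∃ a : A, x = e * a) :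
    (∀ x : FractionRing A,
        (∃ f : Polynomial (FractionRing A), f.Monic ∧
          (∀ i, f.coeff i ∈ (algebraMap A (FractionRing A)).range) ∧ f.eval x = 0) →
        x ∈ (algebraMap A (FractionRing A)).range) ↔
    (∀ p : Ideal (FractionRing A), p.IsPrime →
      ∀ z : FractionRing A ⧸ p,
        (∃ g : Polynomial (FractionRing A ⧸ p), g.Monic ∧
          (∀ i, g.coeff i ∈
            ((Ideal.Quotient.mk p).comp (algebraMap A (FractionRing A))).range) ∧
          g.eval z = 0) →
        z ∈ ((Ideal.Quotient.mk p).comp (algebraMap A (FractionRing A))).range) := by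
  have hann : ∀ a : A, ∃ e : A, e * e = e ∧ ∀ x : A, x * a = 0 ↔ ∃ b : A, x = e * b := by
    intro a
    obtain ⟨e, he, h⟩ := hBaer (Ideal.span {a})
    refine ⟨e, he, fun x ↦ ?_⟩
    rw [← h x]
    refine ⟨fun hx y hy ↦ ?_, fun hx ↦ hx a (Ideal.mem_span_singleton_self a)⟩
    obtain ⟨c, rfl⟩ := Ideal.mem_span_singleton.1 hy
    rw [← mul_assoc, hx, zero_mul]
  have hreg := FractionRing.exists_mul_mul_eq_self hann
  constructor
  · intro hclosed p _ z ⟨g, hg, hcoeff, hz⟩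
    obtain ⟨x, rfl⟩ := Ideal.Quotient.mk_surjective z
    obtain ⟨f, hf, rfl⟩ := hg.exists_monic_map_eq hcoeff
    have hxp : aeval x f ∈ p := by
      rwa [eval_map, ← hom_eval₂, ← aeval_def, Ideal.Quotient.eq_zero_iff_mem] at hz
    obtain ⟨w, ⟨q, hq, hqw⟩, hw⟩ := exists_isIntegral_sub_mem hreg hf hxp
    obtain ⟨a, rfl⟩ := hclosed w ⟨q.map (algebraMap A _), hq.map _,
      fun i ↦ ⟨q.coeff i, (coeff_map _ _).symm⟩, by rwa [eval_map]⟩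
    exact ⟨a, (Ideal.Quotient.eq.2 hw).symm⟩
  · intro hclosed x ⟨f, hf, hcoeff, hx⟩
    refine Subring.mem_of_forall_isPrime_sub_mem _ hreg
      (fun u hu ↦ FractionRing.idempotent_mem_range hann hu) fun p hp ↦ ?_
    have hcoeff' : ∀ i, (f.map (Ideal.Quotient.mk p)).coeff i ∈
        ((Ideal.Quotient.mk p).comp (algebraMap A (FractionRing A))).range := fun i ↦ by
      obtain ⟨a, ha⟩ := hcoeff i
      exact ⟨a, by rw [coeff_map, ← ha, RingHom.comp_apply]⟩
    obtain ⟨a, ha⟩ := hclosed p hp (Ideal.Quotient.mk p x)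
      ⟨f.map (Ideal.Quotient.mk p), hf.map _, hcoeff', by rw [eval_map_apply, hx, map_zero]⟩
    exact ⟨_, ⟨a, rfl⟩, Ideal.Quotient.eq.1 ha.symm⟩
end

section
/- Let A ⊆ B be reduced commutative rings such that B is a rational extension of A and B is generated as a ring by A together with idempotents of B. Let C₁ and C₂ be reduced commutative rings containing B as a subring, and assume that every idempotent e of C₂ for which there exists a ∈ A with a·e ∈ A \ {0} belongs to B. Then every ring isomorphism f : C₁ → C₂ satisfying f(a) = a for all a ∈ A also satisfies f(b) = b for all b ∈ B. -/
/-- Let `A ⊆ B` be reduced commutative rings such that `B` is a rational extension of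
`A` and `B` is generated as a ring by `A` together with the idempotents of `B`.  Let
`C₁`, `C₂` be reduced commutative rings containing `B` as a subring (via injective
ring homomorphisms `ι₁`, `ι₂`), and assume every idempotent `e` of `C₂` for which
there exists `a ∈ A` with `a·e ∈ A \ {0}` belongs to `B`.  Then every ring
isomorphism `f : C₁ → C₂` fixing `A` pointwise also fixes `B` pointwise. -/
theorem ringIso_fixing_A_fixes_baerHull {B C₁ C₂ : Type*} [CommRing B] [IsReduced B]
    [CommRing C₁] [IsReduced C₁] [CommRing C₂] [IsReduced C₂] (A : Subring B)
    (hrat : ∀ b b' : B, b' ≠ 0 → ∃ a ∈ A, a * b ∈ A ∧ a * b' ≠ 0)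
    (hgen : Subring.closure ((A : Set B) ∪ {e : B | e * e = e}) = ⊤)
    (ι₁ : B →+* C₁) (hι₁ : Function.Injective ι₁)
    (ι₂ : B →+* C₂) (hι₂ : Function.Injective ι₂)
    (hidem : ∀ e : C₂, e * e = e →
      (∃ a ∈ A, ∃ a' ∈ A, ι₂ a * e = ι₂ a' ∧ ι₂ a' ≠ 0) → ∃ b : B, ι₂ b = e)
    (f : C₁ ≃+* C₂) (hf : ∀ a ∈ A, f (ι₁ a) = ι₂ a) :
    ∀ b : B, f (ι₁ b) = ι₂ b := by
  have hmem : ∀ b a : B, a ∈ A → a * b ∈ A → ι₂ a * f (ι₁ b) = ι₂ (a * b) := by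
    intro b a ha hab
    rw [← hf _ hab, ← hf a ha, map_mul, map_mul]
  have hfix : ∀ e : B, e * e = e → f (ι₁ e) = ι₂ e := by
    intro e he
    by_cases he0 : e = 0
    · simp [he0]
    obtain ⟨a, ha, hae, hae0⟩ := hrat e e he0
    obtain ⟨g, hg⟩ := hidem (f (ι₁ e)) (by rw [← map_mul, ← map_mul, he])
      ⟨a, ha, a * e, hae, hmem e a ha hae, (map_ne_zero_iff ι₂ hι₂).2 hae0⟩
    suffices h : e = g by rw [← hg, h]
    by_contra hne
    obtain ⟨c, hc, hce, hc0⟩ := hrat e (e - g) (sub_ne_zero.2 hne)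
    have hcg : c * g = c * e := hι₂ (by rw [map_mul, hg, hmem e c hc hce])
    exact hc0 (by rw [mul_sub, hcg, sub_self])
  intro b
  have hb : b ∈ Subring.closure ((A : Set B) ∪ {e : B | e * e = e}) := hgen ▸ Subring.mem_top b
  have heq : Set.EqOn ((f : C₁ →+* C₂).comp ι₁) ι₂ ((A : Set B) ∪ {e : B | e * e = e}) := by
    rintro x (hx | hx)
    · exact hf x hx
    · exact hfix x hx
  exact RingHom.eqOn_set_closure heq hb
end

section
/- Let A be a reduced commutative subring of a commutative ring B, and let C be the subring of B generated by A together with the idempotents of B (i.e. C consists of all finite sums Σᵢ aᵢ·eᵢ with aᵢ ∈ A and eᵢ idempotents of B). Let α be a prime cone of A and let p be a prime ideal of C with p ∩ A = supp(α). Then there exists a prime cone α̃ of C with supp(α̃) = p and α̃ ∩ A = α. -/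
/-- A prime ideal of the subring `S` of a commutative ring `R`, encoded as a subset
`p ⊆ S`: it contains `0`, is closed under addition and multiplication by elements of
`S`, is proper (`1 ∉ p`), and is prime. -/
def IsPrimeIdealOn {R : Type*} [CommRing R] (S : Subring R) (p : Set R) : Prop :=
  p ⊆ ↑S ∧ (0 : R) ∈ p ∧ (∀ x ∈ p, ∀ y ∈ p, x + y ∈ p) ∧
    (∀ x ∈ S, ∀ y ∈ p, x * y ∈ p) ∧ (1 : R) ∉ p ∧
    ∀ x ∈ S, ∀ y ∈ S, x * y ∈ p → x ∈ p ∨ y ∈ p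

/-- A prime cone of the subring `S` of a commutative ring `R`, encoded as a subset
`α ⊆ S`: `α + α ⊆ α`, `α·α ⊆ α`, `x² ∈ α` for all `x ∈ S`, `α ∪ (−α) = S`, and the
support `α ∩ (−α)` is a prime ideal of `S`. -/
def IsPrimeConeOn {R : Type*} [CommRing R] (S : Subring R) (α : Set R) : Prop :=
  α ⊆ ↑S ∧ (∀ x ∈ α, ∀ y ∈ α, x + y ∈ α) ∧ (∀ x ∈ α, ∀ y ∈ α, x * y ∈ α) ∧
    (∀ x ∈ S, x ^ 2 ∈ α) ∧ (∀ x ∈ S, x ∈ α ∨ -x ∈ α) ∧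
    IsPrimeIdealOn S {x | x ∈ α ∧ -x ∈ α}

namespace IsPrimeIdealOn

variable {R : Type*} [CommRing R] {S : Subring R} {p : Set R}

theorem mem (hp : IsPrimeIdealOn S p) {x : R} (hx : x ∈ p) : x ∈ S := hp.1 hx

theorem zero_mem (hp : IsPrimeIdealOn S p) : (0 : R) ∈ p := hp.2.1

theorem add_mem (hp : IsPrimeIdealOn S p) {x y : R} (hx : x ∈ p) (hy : y ∈ p) : x + y ∈ p :=
  hp.2.2.1 x hx y hy

theorem mul_mem_left (hp : IsPrimeIdealOn S p) {x y : R} (hx : x ∈ S) (hy : y ∈ p) :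
    x * y ∈ p :=
  hp.2.2.2.1 x hx y hy

theorem mem_or_mem (hp : IsPrimeIdealOn S p) {x y : R} (hx : x ∈ S) (hy : y ∈ S)
    (hxy : x * y ∈ p) : x ∈ p ∨ y ∈ p :=
  hp.2.2.2.2.2 x hx y hy hxy

theorem neg_mem (hp : IsPrimeIdealOn S p) {x : R} (hx : x ∈ p) : -x ∈ p := by
  simpa using hp.mul_mem_left (S.neg_mem S.one_mem) hx

theorem mul_sub_mul_mem (hp : IsPrimeIdealOn S p) {x y a b : R} (hx : x ∈ S) (hb : b ∈ S)
    (hxa : x - a ∈ p) (hyb : y - b ∈ p) : x * y - a * b ∈ p := by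
  have h := hp.add_mem (hp.mul_mem_left hx hyb) (hp.mul_mem_left hb hxa)
  convert h using 1
  ring

/-- Modulo a prime ideal, every element of the ring generated by `A` and idempotents is
congruent to an element of `A`, since each idempotent is congruent to `0` or `1`. -/
theorem exists_sub_mem_of_mem_closure_idempotents {A : Subring R}
    (hp : IsPrimeIdealOn (Subring.closure ((A : Set R) ∪ {e : R | e * e = e})) p)
    {x : R} (hx : x ∈ Subring.closure ((A : Set R) ∪ {e : R | e * e = e})) :
    ∃ a ∈ A, x - a ∈ p := by
  induction hx using Subring.closure_induction with
  | mem x hx =>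
    rcases hx with hx | hx
    · exact ⟨x, hx, by simpa using hp.zero_mem⟩
    · have hxC : x ∈ Subring.closure ((A : Set R) ∪ {e : R | e * e = e}) :=
        Subring.subset_closure (Set.mem_union_right _ hx)
      have hmul : x * (x - 1) ∈ p := by
        rw [mul_sub, mul_one, show x * x = x from hx, sub_self]
        exact hp.zero_mem
      rcases hp.mem_or_mem hxC (Subring.sub_mem _ hxC (Subring.one_mem _)) hmul with h | h
      · exact ⟨0, A.zero_mem, by simpa using h⟩
      · exact ⟨1, A.one_mem, h⟩
  | zero => exact ⟨0, A.zero_mem, by simpa using hp.zero_mem⟩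
  | one => exact ⟨1, A.one_mem, by simpa using hp.zero_mem⟩
  | add x y _ _ hx hy =>
    obtain ⟨a, ha, hxa⟩ := hx
    obtain ⟨b, hb, hyb⟩ := hy
    exact ⟨a + b, A.add_mem ha hb, by simpa [add_sub_add_comm] using hp.add_mem hxa hyb⟩
  | neg x _ hx =>
    obtain ⟨a, ha, hxa⟩ := hx
    exact ⟨-a, A.neg_mem ha, by simpa [neg_add_eq_sub] using hp.neg_mem hxa⟩
  | mul x y hx _ hx' hy' =>
    obtain ⟨a, ha, hxa⟩ := hx'
    obtain ⟨b, hb, hyb⟩ := hy'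
    exact ⟨a * b, A.mul_mem ha hb,
      hp.mul_sub_mul_mem hx (Subring.subset_closure (Set.mem_union_left _ hb)) hxa hyb⟩

end IsPrimeIdealOn

/-- If `A ≤ C` and every element of `C` is congruent modulo `p` to an element of `A`, then a
prime cone of `A` with support `p ∩ A` lifts to a prime cone of `C` with support `p`. -/
theorem IsPrimeConeOn.exists_lift_of_forall_exists_sub_mem {R : Type*} [CommRing R]
    {A C : Subring R} (hAC : A ≤ C) {α p : Set R} (hα : IsPrimeConeOn A α)
    (hp : IsPrimeIdealOn C p) (hpA : p ∩ ↑A = {x | x ∈ α ∧ -x ∈ α})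
    (hrep : ∀ x ∈ C, ∃ a ∈ A, x - a ∈ p) :
    ∃ β : Set R, IsPrimeConeOn C β ∧ {x | x ∈ β ∧ -x ∈ β} = p ∧ β ∩ ↑A = α := by
  obtain ⟨hαA, hadd, hmul, hsq, htot, hsupp⟩ := hα
  have hsupp_iff : ∀ x, x ∈ p ∧ x ∈ A ↔ x ∈ α ∧ -x ∈ α := fun x => Set.ext_iff.mp hpA x
  have hzero : (0 : R) ∈ α := hsupp.zero_mem.1
  have hmemC : ∀ x a, a ∈ α → x - a ∈ p → x ∈ C := fun x a ha h => by
    simpa using C.add_mem (hp.mem h) (hAC (hαA ha))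
  have hβ : {x | x ∈ {x | ∃ a ∈ α, x - a ∈ p} ∧ -x ∈ {x | ∃ a ∈ α, x - a ∈ p}} = p := by
    ext x
    constructor
    · rintro ⟨⟨a, ha, hxa⟩, b, hb, hxb⟩
      have hab : a + b ∈ p := by
        convert hp.neg_mem (hp.add_mem hxa hxb) using 1
        ring
      have hnab := ((hsupp_iff _).1 ⟨hab, A.add_mem (hαA ha) (hαA hb)⟩).2
      have hna : -a ∈ α := by
        convert hadd _ hnab _ hb using 1
        ring
      simpa using hp.add_mem hxa ((hsupp_iff a).2 ⟨ha, hna⟩).1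
    · exact fun hx => ⟨⟨0, hzero, by simpa using hx⟩, 0, hzero, by simpa using hp.neg_mem hx⟩
  refine ⟨{x | ∃ a ∈ α, x - a ∈ p}, ⟨?_, ?_, ?_, ?_, ?_, hβ.symm ▸ hp⟩, hβ, ?_⟩
  · rintro x ⟨a, ha, hxa⟩
    exact hmemC x a ha hxa
  · rintro x ⟨a, ha, hxa⟩ y ⟨b, hb, hyb⟩
    exact ⟨a + b, hadd a ha b hb, by simpa [add_sub_add_comm] using hp.add_mem hxa hyb⟩
  · rintro x ⟨a, ha, hxa⟩ y ⟨b, hb, hyb⟩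
    exact ⟨a * b, hmul a ha b hb,
      hp.mul_sub_mul_mem (hmemC x a ha hxa) (hAC (hαA hb)) hxa hyb⟩
  · intro x hx
    obtain ⟨a, ha, hxa⟩ := hrep x hx
    refine ⟨a ^ 2, hsq a ha, ?_⟩
    simpa [sq] using hp.mul_sub_mul_mem hx (hAC ha) hxa hxa
  · intro x hx
    obtain ⟨a, ha, hxa⟩ := hrep x hx
    rcases htot a ha with h | h
    · exact Or.inl ⟨a, h, hxa⟩
    · exact Or.inr ⟨-a, h, by simpa [neg_add_eq_sub] using hp.neg_mem hxa⟩
  · ext x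
    constructor
    · rintro ⟨⟨a, ha, hxa⟩, hx⟩
      simpa using hadd _ ((hsupp_iff _).1 ⟨hxa, A.sub_mem hx (hαA ha)⟩).1 _ ha
    · exact fun hx => ⟨⟨x, hx, by simpa using hp.zero_mem⟩, hαA hx⟩

/-- Let `A` be a reduced commutative subring of a commutative ring `B` and `C` the
subring of `B` generated by `A` together with the idempotents of `B`.  Given a prime
cone `α` of `A` and a prime ideal `p` of `C` with `p ∩ A = supp α`, there is a prime
cone `α̃` of `C` with `supp α̃ = p` and `α̃ ∩ A = α`. -/
theorem primeCone_lift_to_idempotent_extension {B : Type*} [CommRing B] (A : Subring B)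
    [IsReduced ↥A]
    (α : Set B) (hα : IsPrimeConeOn A α)
    (p : Set B)
    (hp : IsPrimeIdealOn (Subring.closure ((A : Set B) ∪ {e : B | e * e = e})) p)
    (hpA : p ∩ ↑A = {x | x ∈ α ∧ -x ∈ α}) :
    ∃ β : Set B,
      IsPrimeConeOn (Subring.closure ((A : Set B) ∪ {e : B | e * e = e})) β ∧
        {x | x ∈ β ∧ -x ∈ β} = p ∧ β ∩ ↑A = α := by
  exact hα.exists_lift_of_forall_exists_sub_mem
    (fun _ hx => Subring.subset_closure (Set.mem_union_left _ hx)) hp hpA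
    fun _ hx => hp.exists_sub_mem_of_mem_closure_idempotents hx
end
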